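/- For every m ≥ 1, define a sequence of families of edge sets of CGG(2m) by: A_0 is the family of all SPMs, and for each k ≥ 0, A_{k+1} is the family of all sets of edges that meet every member of A_k and whose cardinality is minimum among all sets of edges meeting every member of A_k. Then A_3 = A_1, and consequently A_k = A_{k−2} for all k ≥ 3. -/

import Mathlib

/-- The vertex set of the complete convex geometric graph `CGG(2m)`:
the vertices are labelled cyclically by `0, 1, …, 2m-1`. -/
abbrev Vtx (m : ℕ) := ZMod (2 * m)

/-- The order of an edge `{i,j}` of `CGG(2m)`: `min (|i-j|, 2m - |i-j|)`. -/
def edgeOrder (m : ℕ) : Sym2 (Vtx m) → ℕ :=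
  Sym2.lift ⟨fun i j => min (i - j).val (j - i).val, fun i j => min_comm _ _⟩

/-- The direction of an edge `{i,j}` of `CGG(2m)`: `i + j (mod 2m)`. -/
def edgeDir (m : ℕ) : Sym2 (Vtx m) → Vtx m :=
  Sym2.lift ⟨fun i j => i + j, fun i j => add_comm i j⟩

/-- `x` lies on the open cyclic arc from `a` to `b`, taken counterclockwise. -/
def InArc (m : ℕ) (a b x : Vtx m) : Prop :=
  0 < (x - a).val ∧ (x - a).val < (b - a).val

/-- Two edges of `CGG(2m)` cross: their endpoints interleave in the cyclic order,
i.e. writing them as `{a,b}` and `{c,d}`, exactly one of `c, d` lies on the open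
cyclic arc from `a` to `b` taken counterclockwise. -/
def Crosses (m : ℕ) (e f : Sym2 (Vtx m)) : Prop :=
  ∃ a b c d : Vtx m, e = s(a, b) ∧ f = s(c, d) ∧
    Xor' (InArc m a b c) (InArc m a b d)

/-- Two edges of `CGG(2m)` are neighbors: some endpoint of one differs by `±1`
(mod `2m`) from some endpoint of the other. -/
def Neighbors (m : ℕ) (e f : Sym2 (Vtx m)) : Prop :=
  ∃ x ∈ e, ∃ y ∈ f, x = y + 1 ∨ y = x + 1

/-- `M` is a perfect matching of `CGG(2m)`: a set of pairwise vertex-disjoint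
edges covering all `2m` vertices. -/
def IsPM (m : ℕ) (M : Finset (Sym2 (Vtx m))) : Prop :=
  (∀ e ∈ M, ¬ e.IsDiag) ∧
  (∀ e ∈ M, ∀ f ∈ M, e ≠ f → ∀ x : Vtx m, x ∈ e → x ∉ f) ∧
  (∀ x : Vtx m, ∃ e ∈ M, x ∈ e)

/-- `M` is a simple perfect matching (SPM) of `CGG(2m)`: a perfect matching
no two of whose edges cross. -/
def IsSPM (m : ℕ) (M : Finset (Sym2 (Vtx m))) : Prop :=
  IsPM m M ∧ ∀ e ∈ M, ∀ f ∈ M, e ≠ f → ¬ Crosses m e f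

/-- `M` is a semi-simple perfect matching of `CGG(2m)`: a perfect matching all of
whose edges have odd order, and no two neighboring edges of which cross. -/
def IsSemiSimple (m : ℕ) (M : Finset (Sym2 (Vtx m))) : Prop :=
  IsPM m M ∧ (∀ e ∈ M, Odd (edgeOrder m e)) ∧
  ∀ e ∈ M, ∀ f ∈ M, e ≠ f → Neighbors m e f → ¬ Crosses m e f

/-- `B` is a set of edges of `CGG(2m)` that meets every member of the family `F`,
of minimum cardinality among all sets of edges meeting every member of `F`. -/
def MinTransversal (m : ℕ) (F : Set (Finset (Sym2 (Vtx m))))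
    (B : Finset (Sym2 (Vtx m))) : Prop :=
  (∀ e ∈ B, ¬ e.IsDiag) ∧ (∀ M ∈ F, (B ∩ M).Nonempty) ∧
  ∀ B' : Finset (Sym2 (Vtx m)), (∀ e ∈ B', ¬ e.IsDiag) →
    (∀ M ∈ F, (B' ∩ M).Nonempty) → B.card ≤ B'.card

/-- `B` is a blocker of `CGG(2m)`: a set of edges meeting every SPM, of minimum
cardinality among all sets of edges meeting every SPM. -/
def IsBlocker (m : ℕ) (B : Finset (Sym2 (Vtx m))) : Prop :=
  MinTransversal m {M | IsSPM m M} B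

/-- `C` is a co-blocker of `CGG(2m)`: a set of edges meeting every blocker, of
minimum cardinality among all sets of edges meeting every blocker. -/
def IsCoBlocker (m : ℕ) (C : Finset (Sym2 (Vtx m))) : Prop :=
  MinTransversal m {B | IsBlocker m B} C

/-- A double is never congruent to an odd number modulo `2 * m`. -/
theorem two_mul_natCast_ne_odd {m : ℕ} (a b : ℕ) :
    ((2 * a : ℕ) : Vtx m) ≠ ((2 * b + 1 : ℕ) : Vtx m) := by
  intro h
  have h2 := ((ZMod.natCast_eq_natCast_iff _ _ _).1 h).of_dvd (dvd_mul_right 2 m)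
  unfold Nat.ModEq at h2
  omega

theorem natCast_vtx_inj {m a b : ℕ} (ha : a < 2 * m) (hb : b < 2 * m)
    (h : (a : Vtx m) = (b : Vtx m)) : a = b := by
  have h2 := (ZMod.natCast_eq_natCast_iff _ _ _).1 h
  exact Nat.ModEq.eq_of_lt_of_lt h2 ha hb

/-- The parallel class of all edges with direction `c`. -/
def parallelClass (m : ℕ) [NeZero (2 * m)] (c : Vtx m) : Finset (Sym2 (Vtx m)) :=
  Finset.univ.image fun x => s(x, c - x)

theorem eq_of_mem_parallelClass {m : ℕ} [NeZero (2 * m)] {c x : Vtx m}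
    {e : Sym2 (Vtx m)} (he : e ∈ parallelClass m c) (hx : x ∈ e) : e = s(x, c - x) := by
  obtain ⟨y, -, rfl⟩ := Finset.mem_image.1 he
  rcases Sym2.mem_iff.1 hx with rfl | rfl
  · rfl
  · rw [sub_sub_cancel, Sym2.eq_swap]

theorem edgeDir_of_mem_parallelClass {m : ℕ} [NeZero (2 * m)] {c : Vtx m}
    {e : Sym2 (Vtx m)} (he : e ∈ parallelClass m c) : edgeDir m e = c := by
  obtain ⟨y, -, rfl⟩ := Finset.mem_image.1 he
  simp [edgeDir]

theorem val_sub_between {n : ℕ} [NeZero n] {u w : ZMod n} (h0 : 0 < u.val)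
    (h1 : u.val < w.val) : 0 < (w - u).val ∧ (w - u).val < w.val := by
  rw [ZMod.val_sub h1.le]
  omega

theorem inArc_sub {m : ℕ} [NeZero (2 * m)] {a c x : Vtx m} (h : InArc m a (c - a) x) :
    InArc m a (c - a) (c - x) := by
  have h2 := val_sub_between h.1 h.2
  have h3 : c - a - a - (x - a) = c - x - a := by ring
  rw [h3] at h2
  exact h2

theorem isSPM_parallelClass (m : ℕ) [NeZero (2 * m)] (k : ℕ) :
    IsSPM m (parallelClass m ((2 * k + 1 : ℕ) : Vtx m)) := by
  refine ⟨⟨?_, ?_, ?_⟩, ?_⟩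
  · intro e he hd
    obtain ⟨x, -, rfl⟩ := Finset.mem_image.1 he
    rw [Sym2.mk_isDiag_iff, eq_sub_iff_add_eq, ← two_mul] at hd
    apply two_mul_natCast_ne_odd (m := m) x.val k
    rw [← hd, Nat.cast_mul, ZMod.natCast_zmod_val, Nat.cast_two]
  · intro e he f hf hne x hxe hxf
    exact hne ((eq_of_mem_parallelClass he hxe).trans (eq_of_mem_parallelClass hf hxf).symm)
  · intro x
    exact ⟨s(x, _ - x), Finset.mem_image_of_mem _ (Finset.mem_univ x), Sym2.mem_mk_left _ _⟩
  · rintro e he f hf - ⟨a, b, c, d, rfl, rfl, hx⟩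
    have h1 := eq_of_mem_parallelClass he (Sym2.mem_mk_left a b)
    have h2 := eq_of_mem_parallelClass hf (Sym2.mem_mk_left c d)
    rw [Sym2.congr_right] at h1 h2
    subst h1 h2
    rcases hx with ⟨h, hn⟩ | ⟨h, hn⟩
    · exact hn (inArc_sub h)
    · have := inArc_sub h
      rw [sub_sub_cancel] at this
      exact hn this

/-- If a set meets each of `m` pairwise disjoint sets, it has at least `m` elements. -/
theorem le_card_of_meets_disjoint {α : Type*} [DecidableEq α] {m : ℕ} (F : Fin m → Finset α)
    (hF : ∀ i j, ∀ e ∈ F i, e ∈ F j → i = j) (B : Finset α)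
    (hB : ∀ i, (B ∩ F i).Nonempty) : m ≤ B.card := by
  choose f hf using hB
  rw [← Finset.card_fin m]
  refine Finset.card_le_card_of_injOn f (fun i _ => (Finset.mem_inter.1 (hf i)).1)
    (fun i _ j _ hij => hF i j (f i) (Finset.mem_inter.1 (hf i)).2 ?_)
  rw [hij]
  exact (Finset.mem_inter.1 (hf j)).2

theorem le_card_of_meets_isSPM {m : ℕ} [NeZero (2 * m)] (B : Finset (Sym2 (Vtx m)))
    (hB : ∀ M, IsSPM m M → (B ∩ M).Nonempty) : m ≤ B.card := by
  refine le_card_of_meets_disjoint (fun i => parallelClass m ((2 * (i : ℕ) + 1 : ℕ) : Vtx m))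
    (fun i j e he he' => Fin.ext ?_) B (fun i => hB _ (isSPM_parallelClass m i))
  have := natCast_vtx_inj (by omega) (by omega)
    ((edgeDir_of_mem_parallelClass he).symm.trans (edgeDir_of_mem_parallelClass he'))
  omega

theorem IsPM.exists_partner {m : ℕ} {M : Finset (Sym2 (Vtx m))} (h : IsPM m M) :
    ∃ p : Vtx m → Vtx m, (∀ x, s(x, p x) ∈ M) ∧ (∀ x, p x ≠ x) ∧ ∀ x, p (p x) = x := by
  have h1 : ∀ x, ∃ y, s(x, y) ∈ M := by
    intro x
    obtain ⟨e, he, y, rfl⟩ := h.2.2 x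
    exact ⟨y, he⟩
  choose p hp using h1
  refine ⟨p, hp, fun x hx => ?_, fun x => ?_⟩
  · exact h.1 _ (hp x) (Sym2.mk_isDiag_iff.2 hx.symm)
  · by_contra hne
    refine h.2.1 _ (hp x) _ (hp (p x)) (fun heq => hne ?_) (p x)
      (Sym2.mem_mk_right _ _) (Sym2.mem_mk_left _ _)
    rw [Sym2.eq_swap, Sym2.congr_right] at heq
    exact heq.symm

theorem IsPM.card_le {m : ℕ} [NeZero (2 * m)] {M : Finset (Sym2 (Vtx m))}
    (h : IsPM m M) : M.card ≤ m := by
  have h1 : (M.biUnion Sym2.toFinset).card = ∑ e ∈ M, e.toFinset.card := by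
    refine Finset.card_biUnion fun e he f hf hne => ?_
    rw [Function.onFun, Finset.disjoint_left]
    intro x hx hx'
    exact h.2.1 e he f hf hne x (Sym2.mem_toFinset.1 hx) (Sym2.mem_toFinset.1 hx')
  rw [Finset.sum_congr rfl fun e he => Sym2.card_toFinset_of_not_isDiag e (h.1 e he),
    Finset.sum_const, smul_eq_mul] at h1
  have h2 := Finset.card_le_univ (M.biUnion Sym2.toFinset)
  rw [ZMod.card] at h2
  omega

theorem card_inArc {m : ℕ} [NeZero (2 * m)] (a b : Vtx m) [DecidablePred (InArc m a b)] :
    (Finset.univ.filter (InArc m a b)).card = (b - a).val - 1 := by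
  have h : (Finset.univ.filter (InArc m a b)).card = (Finset.Ioo 0 (b - a).val).card := by
    refine Finset.card_bij (fun x _ => (x - a).val) (fun x hx => ?_) (fun x _ y _ hxy => ?_)
      (fun n hn => ?_)
    · exact Finset.mem_Ioo.2 (Finset.mem_filter.1 hx).2
    · exact sub_left_injective (ZMod.val_injective _ hxy)
    · rw [Finset.mem_Ioo] at hn
      have hv : ((n : Vtx m)).val = n :=
        ZMod.val_natCast_of_lt (hn.2.trans (ZMod.val_lt _))
      refine ⟨a + n, Finset.mem_filter.2 ⟨Finset.mem_univ _, ?_⟩, ?_⟩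
      · rw [InArc, add_sub_cancel_left, hv]
        exact hn
      · rw [add_sub_cancel_left, hv]
  rw [h, Nat.card_Ioo, Nat.sub_zero]

/-- Edges of a simple perfect matching join vertices at odd distance. -/
theorem IsSPM.odd_val_sub {m : ℕ} [NeZero (2 * m)] {M : Finset (Sym2 (Vtx m))}
    (h : IsSPM m M) {a b : Vtx m} (hab : s(a, b) ∈ M) : Odd (b - a).val := by
  classical
  obtain ⟨p, hp, hne, hinv⟩ := h.1.exists_partner
  have hsum : ∑ _x ∈ Finset.univ.filter (InArc m a b), (1 : ZMod 2) = 0 := by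
    refine Finset.sum_involution (fun x _ => p x) (fun _ _ => by decide)
      (fun x _ _ => hne x) (fun x hx => ?_) (fun x _ => hinv x)
    rw [Finset.mem_filter] at hx ⊢
    refine ⟨Finset.mem_univ _, ?_⟩
    by_contra hpx
    refine h.2 _ hab _ (hp x) (fun heq => ?_) ⟨a, b, x, p x, rfl, rfl, Or.inl ⟨hx.2, hpx⟩⟩
    have hx' : x ∈ s(a, b) := heq ▸ Sym2.mem_mk_left x (p x)
    rcases Sym2.mem_iff.1 hx' with rfl | rfl
    · simpa using hx.2.1
    · exact lt_irrefl _ hx.2.2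
  rw [Finset.sum_const, nsmul_one, ZMod.natCast_eq_zero_iff, card_inArc] at hsum
  have hpos : (b - a).val ≠ 0 := by
    rw [ne_eq, ZMod.val_eq_zero, sub_eq_zero]
    rintro rfl
    exact h.1.1 _ hab (Sym2.mk_isDiag_iff.2 rfl)
  rw [Nat.odd_iff]
  omega

/-- The star of all edges of odd order at the vertex `v`. -/
def oddStar (m : ℕ) (v : Vtx m) : Finset (Sym2 (Vtx m)) :=
  (Finset.range m).image fun i => s(v, v + ((2 * i + 1 : ℕ) : Vtx m))

theorem isBlocker_oddStar {m : ℕ} [NeZero (2 * m)] (v : Vtx m) :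
    IsBlocker m (oddStar m v) := by
  refine ⟨fun e he hd => ?_, fun M hM => ?_, fun B' _ hB' => ?_⟩
  · obtain ⟨i, -, rfl⟩ := Finset.mem_image.1 he
    rw [Sym2.mk_isDiag_iff, left_eq_add] at hd
    exact two_mul_natCast_ne_odd (m := m) 0 i (by rw [hd, mul_zero, Nat.cast_zero])
  · obtain ⟨p, hp, -⟩ := IsPM.exists_partner hM.1
    obtain ⟨i, hi⟩ := IsSPM.odd_val_sub hM (hp v)
    have hlt := ZMod.val_lt (p v - v)
    refine ⟨s(v, p v), Finset.mem_inter.2 ⟨Finset.mem_image.2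
      ⟨i, Finset.mem_range.2 (by omega), ?_⟩, hp v⟩⟩
    rw [← hi, ZMod.natCast_zmod_val, add_sub_cancel]
  · refine (Finset.card_image_le.trans_eq (Finset.card_range m)).trans ?_
    exact le_card_of_meets_isSPM B' hB'

theorem le_card_of_meets_isBlocker {m : ℕ} [NeZero (2 * m)] (C : Finset (Sym2 (Vtx m)))
    (hC : ∀ B, IsBlocker m B → (C ∩ B).Nonempty) : m ≤ C.card := by
  refine le_card_of_meets_disjoint (fun i => oddStar m ((2 * (i : ℕ) : ℕ) : Vtx m))
    (fun i j e he he' => Fin.ext ?_) C (fun i => hC _ (isBlocker_oddStar _))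
  obtain ⟨k, -, rfl⟩ := Finset.mem_image.1 he
  obtain ⟨l, -, hl⟩ := Finset.mem_image.1 he'
  have hmem : ((2 * (i : ℕ) : ℕ) : Vtx m) ∈
      s(((2 * (j : ℕ) : ℕ) : Vtx m), ((2 * (j : ℕ) : ℕ) : Vtx m) + ((2 * l + 1 : ℕ) : Vtx m)) := by
    rw [hl]
    exact Sym2.mem_mk_left _ _
  rcases Sym2.mem_iff.1 hmem with h | h
  · have := natCast_vtx_inj (by omega) (by omega) h
    omega
  · rw [← Nat.cast_add, ← add_assoc, ← mul_add] at h
    exact absurd h (two_mul_natCast_ne_odd _ _)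

theorem IsSPM.isCoBlocker {m : ℕ} [NeZero (2 * m)] {M : Finset (Sym2 (Vtx m))}
    (h : IsSPM m M) : IsCoBlocker m M := by
  refine ⟨h.1.1, fun B hB => ?_, fun C _ hC => ?_⟩
  · rw [Finset.inter_comm]
    exact hB.2.1 M h
  · exact h.1.card_le.trans (le_card_of_meets_isBlocker C hC)

/-- A family with a minimum transversal, all of whose members are minimum transversals of its
minimum transversals, has the same minimum transversals as this second iterate. -/
theorem minTransversal_iterate_iff {m : ℕ} {F : Set (Finset (Sym2 (Vtx m)))}
    (hne : ∃ B, MinTransversal m F B)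
    (hF : F ⊆ {C | MinTransversal m {B | MinTransversal m F B} C})
    (B : Finset (Sym2 (Vtx m))) :
    MinTransversal m {C | MinTransversal m {B | MinTransversal m F B} C} B ↔
      MinTransversal m F B := by
  have key : ∀ B, MinTransversal m F B →
      ∀ C ∈ {C | MinTransversal m {B | MinTransversal m F B} C}, (B ∩ C).Nonempty := by
    intro B hB C hC
    rw [Finset.inter_comm]
    exact hC.2.1 B hB
  constructor
  · intro hB
    obtain ⟨B₀, hB₀⟩ := hne
    exact ⟨hB.1, fun M hM => hB.2.1 M (hF hM), fun B' hd hB' =>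
      (hB.2.2 B₀ hB₀.1 (key B₀ hB₀)).trans (hB₀.2.2 B' hd hB')⟩
  · intro hB
    exact ⟨hB.1, key B hB, fun B' hd hB' => hB.2.2 B' hd fun M hM => hB' M (hF hM)⟩

/-- Define `A 0` as the family of all SPMs of `CGG(2m)`, and `A (k+1)` as the
family of all minimum-cardinality sets of edges meeting every member of `A k`.
Then `A 3 = A 1`, and consequently `A k = A (k-2)` for all `k ≥ 3`. -/
theorem sequence_periodic (m : ℕ) (hm : 1 ≤ m)
    (A : ℕ → Set (Finset (Sym2 (Vtx m))))
    (hA0 : A 0 = {M | IsSPM m M})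
    (hAsucc : ∀ k : ℕ, A (k + 1) = {B | MinTransversal m (A k) B}) :
    A 3 = A 1 ∧ ∀ k : ℕ, 3 ≤ k → A k = A (k - 2) := by
  have : NeZero (2 * m) := ⟨by omega⟩
  have h31 : A 3 = A 1 := by
    rw [hAsucc 2, hAsucc 1, hAsucc 0, hA0]
    ext B
    exact minTransversal_iterate_iff ⟨_, isBlocker_oddStar 0⟩ (fun M hM => IsSPM.isCoBlocker hM) B
  refine ⟨h31, fun k hk => ?_⟩
  induction k, hk using Nat.le_induction with
  | base => exact h31
  | succ k hk ih =>
    have hsub : k + 1 - 2 = (k - 2) + 1 := by omega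
    rw [hsub, hAsucc k, hAsucc (k - 2), ih]
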